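/- Let G be a finite group and Q a 2-subgroup of G (a subgroup whose order is a power of 2). Then Q is a perfect code of G if and only if Q is a perfect code of every Sylow 2-subgroup of G that contains Q. -/

import Mathlib

/-- A subgroup `H` of a finite group `G` is a *perfect code* of `G` if there exists a subset
`T` of `G` that is inverse-closed and is a right transversal of `H` in `G` (i.e., every element
of `G` can be written uniquely as `h * t` with `h ∈ H` and `t ∈ T`). -/
def Subgroup.IsPerfectCode {G : Type*} [Group G] (H : Subgroup G) : Prop :=
  ∃ T : Set G, T⁻¹ = T ∧ Subgroup.IsComplement (H : Set G) T

open MulAction in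
/-- The orbits of `Q` on `G ⧸ Q` are the double cosets of `Q`, so inversion exchanges the orbit of
`a` with the orbit of `a⁻¹`. -/
lemma QuotientGroup.inv_mem_orbit_inv {G : Type*} [Group G] {Q : Subgroup G} {a b : G}
    (h : (b : G ⧸ Q) ∈ orbit Q (a : G ⧸ Q)) :
    ((b⁻¹ : G) : G ⧸ Q) ∈ orbit Q ((a⁻¹ : G) : G ⧸ Q) := by
  obtain ⟨q, hq⟩ := h
  have hq : (((q : G) * a : G) : G ⧸ Q) = b := hq
  rw [QuotientGroup.eq] at hq
  refine ⟨⟨_, Q.inv_mem hq⟩, ?_⟩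
  change (((((q : G) * a)⁻¹ * b)⁻¹ * a⁻¹ : G) : G ⧸ Q) = _
  rw [QuotientGroup.eq]
  convert Q.inv_mem q.2 using 1
  group

open MulAction in
/-- A left coset and a right coset in the same double coset meet. -/
lemma QuotientGroup.exists_mk_eq_and_mk_inv_eq {G : Type*} [Group G] {Q : Subgroup G} {a b : G}
    (h : (b : G ⧸ Q) ∈ orbit Q ((a⁻¹ : G) : G ⧸ Q)) :
    ∃ t : G, (t : G ⧸ Q) = a ∧ ((t⁻¹ : G) : G ⧸ Q) = b := by
  obtain ⟨q, hq⟩ := h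
  have hq : (((q : G) * a⁻¹ : G) : G ⧸ Q) = b := hq
  refine ⟨a * (q : G)⁻¹, ?_, ?_⟩
  · rw [QuotientGroup.eq]
    simp
  · rw [← hq]
    simp

open MulAction in
lemma QuotientGroup.ncard_orbit_inv {G : Type*} [Group G] [Finite G] (Q : Subgroup G) (a : G) :
    (orbit Q ((a⁻¹ : G) : G ⧸ Q)).ncard = (orbit Q (a : G ⧸ Q)).ncard := by
  have key (c : G) : ((QuotientGroup.mk : G → G ⧸ Q) ⁻¹' orbit Q (c : G ⧸ Q)).ncard =
      Nat.card Q * (orbit Q (c : G ⧸ Q)).ncard := by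
    rw [← Nat.card_coe_set_eq, Nat.card_congr (QuotientGroup.preimageMkEquivSubgroupProdSet Q _),
      Nat.card_prod, Nat.card_coe_set_eq]
  refine Nat.eq_of_mul_eq_mul_left (Nat.card_pos (α := Q)) ?_
  rw [← key, ← key, ← Set.ncard_inv]
  congr 1
  ext g
  simp only [Set.mem_inv, Set.mem_preimage]
  exact ⟨fun h => by simpa using inv_mem_orbit_inv h, fun h => inv_mem_orbit_inv h⟩

/-- An inverse-closed subset of odd cardinality of a group contains a self-inverse element. -/
lemma Set.exists_inv_eq_self_of_odd_ncard {G : Type*} [Group G] [Finite G] {A : Set G}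
    (hA : A⁻¹ = A) (hodd : Odd A.ncard) : ∃ t ∈ A, t⁻¹ = t := by
  classical
  have := Fintype.ofFinite A
  have hmem (t : A) : (t : G)⁻¹ ∈ A := by
    have := Set.inv_mem_inv.2 t.2
    rwa [hA] at this
  let f : A → A := fun t => ⟨(t : G)⁻¹, hmem t⟩
  have hf : Function.Involutive f := fun t => by simp [f]
  have : Fact (Nat.Prime 2) := ⟨Nat.prime_two⟩
  obtain ⟨t, ht⟩ := Equiv.Perm.exists_fixed_point_of_prime (p := 2) (n := 1)
    (σ := hf.toPerm) (by
      rw [← Nat.card_eq_fintype_card, Nat.card_coe_set_eq]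
      exact hodd.not_two_dvd_nat)
    (by
      ext t
      simp [pow_two, hf t])
  exact ⟨t, t.2, congrArg Subtype.val ht⟩

/-- An inverse-closed set of representatives of left cosets is also a right transversal. -/
lemma Subgroup.isPerfectCode_of_bijOn {G : Type*} [Group G] {Q : Subgroup G} {T : Set G}
    (hT : T⁻¹ = T) (hinj : T.InjOn (QuotientGroup.mk : G → G ⧸ Q))
    (hsurj : ∀ a : G, ∃ t ∈ T, (t : G ⧸ Q) = a) : Q.IsPerfectCode := by
  have hinv {t : G} (ht : t ∈ T) : t⁻¹ ∈ T := by
    rw [← hT]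
    simpa using ht
  refine ⟨T, hT, isComplement_iff_existsUnique_mul_inv_mem.2 fun g => ?_⟩
  obtain ⟨t, ht, htg⟩ := hsurj g⁻¹
  refine ⟨⟨t⁻¹, hinv ht⟩, ?_, fun s hs => ?_⟩
  · simpa using QuotientGroup.eq.1 htg.symm
  · have hsg : (((s : G)⁻¹ : G) : G ⧸ Q) = (g⁻¹ : G) := by
      rw [eq_comm, QuotientGroup.eq]
      simpa using hs
    exact Subtype.ext (inv_eq_iff_eq_inv.1 (hinj (hinv s.2) ht (hsg.trans htg.symm)))

open MulAction in
/-- Criterion for a `2`-subgroup to be a perfect code. -/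
lemma Subgroup.isPerfectCode_of_exists_inv_eq_self {G : Type*} [Group G] [Finite G]
    {Q : Subgroup G} (hQ : IsPGroup 2 Q)
    (h : ∀ x ∈ normalizer (Q : Set G), x * x ∈ Q → ∃ t : G, (t : G ⧸ Q) = x ∧ t⁻¹ = t) :
    Q.IsPerfectCode := by
  have : Fact (Nat.Prime 2) := ⟨Nat.prime_two⟩
  -- Take a maximal inverse-closed partial transversal whose self-inverse elements normalize `Q`.
  let Good : Set (Set G) := {T | T⁻¹ = T ∧ T.InjOn (QuotientGroup.mk : G → G ⧸ Q) ∧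
    ∀ t ∈ T, t⁻¹ = t → t ∈ normalizer (Q : Set G)}
  obtain ⟨T, hT⟩ := (Set.toFinite Good).exists_maximal ⟨∅, by simp [Good]⟩
  obtain ⟨hTinv, hTinj, hTnorm⟩ := hT.prop
  have hinv {t : G} (ht : t ∈ T) : t⁻¹ ∈ T := by
    rw [← hTinv]
    simpa using ht
  refine isPerfectCode_of_bijOn hTinv hTinj ?_
  by_contra! hex
  obtain ⟨a, ha⟩ := hex
  have hno (t : G) (hta : (t : G ⧸ Q) = a) (ht : t⁻¹ = t) : t ∉ normalizer (Q : Set G) := by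
    intro htn
    have hgood : insert t T ∈ Good := by
      refine ⟨?_, ?_, ?_⟩
      · rw [Set.inv_insert, hTinv, ht]
      · rw [Set.injOn_insert fun htT => ha t htT hta]
        refine ⟨hTinj, ?_⟩
        rintro ⟨s, hs, hst⟩
        exact ha s hs (hst.trans hta)
      · rintro s (rfl | hs) hss
        exacts [htn, hTnorm s hs hss]
    exact ha t (hT.le_of_ge hgood (Set.subset_insert t T) (Set.mem_insert t T)) hta
  have hcov (b : G) (hb : (b : G ⧸ Q) ∈ orbit Q ((a⁻¹ : G) : G ⧸ Q))
      (hba : (b : G ⧸ Q) ≠ a) : ∃ t ∈ T, (t : G ⧸ Q) = b := by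
    by_contra! hbT
    obtain ⟨t, hta, htb⟩ := QuotientGroup.exists_mk_eq_and_mk_inv_eq hb
    have hne : t⁻¹ ≠ t := fun ht => hba (by rw [← htb, ht, hta])
    have hgood : insert t (insert t⁻¹ T) ∈ Good := by
      refine ⟨?_, ?_, ?_⟩
      · rw [Set.inv_insert, Set.inv_insert, hTinv, inv_inv, Set.insert_comm]
      · rw [Set.injOn_insert, Set.injOn_insert fun h' => hbT _ h' htb]
        · refine ⟨⟨hTinj, ?_⟩, ?_⟩
          · rintro ⟨s, hs, hst⟩
            exact hbT s hs (hst.trans htb)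
          · rintro ⟨s, rfl | hs, hst⟩
            · exact hba (by rw [← htb, hst, hta])
            · exact ha s hs (hst.trans hta)
        · rintro (h' | h')
          exacts [hne h'.symm, ha t h' hta]
      · rintro s (rfl | rfl | hs) hss
        exacts [(hne hss).elim, (hne (by simpa using hss.symm)).elim, hTnorm s hs hss]
    exact ha t (hT.le_of_ge hgood
      ((Set.subset_insert _ _).trans (Set.subset_insert _ _)) (Set.mem_insert _ _)) hta
  have hinjOn (O : Set (G ⧸ Q)) :
      (QuotientGroup.mk '' (T ∩ QuotientGroup.mk ⁻¹' O) : Set (G ⧸ Q)).ncard =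
        (T ∩ QuotientGroup.mk ⁻¹' O).ncard :=
    (hTinj.mono Set.inter_subset_left).ncard_image
  set A : Set G := T ∩ QuotientGroup.mk ⁻¹' orbit Q (a : G ⧸ Q) with hA
  set B : Set G := T ∩ QuotientGroup.mk ⁻¹' orbit Q ((a⁻¹ : G) : G ⧸ Q) with hB
  have hAB : A⁻¹ = B := by
    ext g
    simp only [hA, hB, Set.mem_inv, Set.mem_inter_iff, Set.mem_preimage]
    exact ⟨fun h => ⟨by simpa using hinv h.1,
        by simpa using QuotientGroup.inv_mem_orbit_inv h.2⟩,
      fun h => ⟨hinv h.1, by simpa using QuotientGroup.inv_mem_orbit_inv h.2⟩⟩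
  by_cases haa : (a : G ⧸ Q) ∈ orbit Q ((a⁻¹ : G) : G ⧸ Q)
  · have horb : orbit Q (a : G ⧸ Q) = orbit Q ((a⁻¹ : G) : G ⧸ Q) := orbit_eq_iff.2 haa
    have hAinv : A⁻¹ = A := by rw [hAB, hA, hB, horb]
    have himg : (QuotientGroup.mk '' A : Set (G ⧸ Q)) = orbit Q (a : G ⧸ Q) \ {(a : G ⧸ Q)} := by
      ext b
      constructor
      · rintro ⟨t, ht, rfl⟩
        exact ⟨ht.2, ha t ht.1⟩
      · induction b using QuotientGroup.induction_on with
        | H b =>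
          rintro ⟨hb, hba⟩
          obtain ⟨t, ht, htb⟩ := hcov b (horb ▸ hb) hba
          exact ⟨t, ⟨ht, by rwa [Set.mem_preimage, htb]⟩, htb⟩
    have hcard : A.ncard + 1 = (orbit Q (a : G ⧸ Q)).ncard := by
      rw [← hinjOn, himg, Set.ncard_sdiff_singleton_add_one (mem_orbit_self _)]
    obtain ⟨n, hn⟩ := hQ.card_orbit (a : G ⧸ Q)
    rw [Nat.card_coe_set_eq] at hn
    have hfix (t : G) (ht : (t : G ⧸ Q) ∈ orbit Q (a : G ⧸ Q)) :
        t ∈ normalizer (Q : Set G) ↔ n = 0 := by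
      rw [← Sylow.mem_fixedPoints_mul_left_cosets_iff_mem_normalizer,
        ← subsingleton_orbit_iff_mem_fixedPoints, orbit_eq_iff.2 ht,
        ← Set.ncard_le_one_iff_subsingleton, hn]
      constructor
      · intro h1
        by_contra h0
        exact absurd (Nat.one_lt_two_pow h0) (by omega)
      · rintro rfl
        simp
    by_cases h0 : n = 0
    · have han := (hfix a (mem_orbit_self _)).2 h0
      have hsub := subsingleton_orbit_iff_mem_fixedPoints.2
        (Sylow.mem_fixedPoints_mul_left_cosets_iff_mem_normalizer.2 han)
      have hsq : a * a ∈ Q := by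
        have := hsub (horb ▸ mem_orbit_self ((a⁻¹ : G) : G ⧸ Q)) (mem_orbit_self (a : G ⧸ Q))
        simpa using QuotientGroup.eq.1 this
      obtain ⟨t, hta, ht⟩ := h a han hsq
      exact hno t hta ht ((hfix t (hta ▸ mem_orbit_self _)).2 h0)
    · have hodd : Odd A.ncard := by
        have : Even (2 ^ n) := (Nat.even_pow.2 ⟨even_two, h0⟩)
        rw [← hn, ← hcard, Nat.even_add_one] at this
        exact Nat.not_even_iff_odd.1 this
      obtain ⟨t, ht, htt⟩ := Set.exists_inv_eq_self_of_odd_ncard hAinv hodd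
      exact h0 ((hfix t ht.2).1 (hTnorm t ht.1 htt))
  · have himg : (QuotientGroup.mk '' B : Set (G ⧸ Q)) = orbit Q ((a⁻¹ : G) : G ⧸ Q) := by
      ext b
      constructor
      · rintro ⟨t, ht, rfl⟩
        exact ht.2
      · induction b using QuotientGroup.induction_on with
        | H b =>
          intro hb
          obtain ⟨t, ht, htb⟩ := hcov b hb fun hba => haa (hba ▸ hb)
          exact ⟨t, ⟨ht, by rwa [Set.mem_preimage, htb]⟩, htb⟩
    have hlt : (QuotientGroup.mk '' A : Set (G ⧸ Q)).ncard < (orbit Q (a : G ⧸ Q)).ncard := by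
      refine Set.ncard_lt_ncard ⟨?_, fun hle => ?_⟩
      · rintro _ ⟨t, ht, rfl⟩
        exact ht.2
      · obtain ⟨t, ht, hta⟩ := hle (mem_orbit_self _)
        exact ha t ht.1 hta
    rw [hinjOn, ← Set.ncard_inv, hAB, ← hinjOn, himg, QuotientGroup.ncard_orbit_inv] at hlt
    exact lt_irrefl _ hlt

lemma Subgroup.IsPerfectCode.subgroupOf {G : Type*} [Group G] {Q : Subgroup G}
    (h : Q.IsPerfectCode) {P : Subgroup G} (hQP : Q ≤ P) : (Q.subgroupOf P).IsPerfectCode := by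
  obtain ⟨T, hT, hc⟩ := h
  refine ⟨Subtype.val ⁻¹' T, ?_, ?_⟩
  · ext g
    rw [Set.mem_inv, Set.mem_preimage, Set.mem_preimage, coe_inv, ← Set.mem_inv, hT]
  · rw [isComplement_iff_existsUnique_mul_inv_mem] at hc ⊢
    intro g
    obtain ⟨t, ht, huniq⟩ := hc g
    have htP : (t : G) ∈ P := by
      simpa using P.mul_mem (P.inv_mem (hQP ht)) g.2
    refine ⟨⟨⟨t, htP⟩, t.2⟩, ht, fun s hs => ?_⟩
    have hst : ((s : P) : G) = t := congrArg Subtype.val (huniq ⟨s, s.2⟩ hs)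
    exact Subtype.ext (Subtype.ext hst)

/-- If `x` normalizes a perfect code `Q` and `x ^ 2 ∈ Q`, then `x * Q` contains a self-inverse
element. -/
lemma Subgroup.IsPerfectCode.exists_inv_eq_self {G : Type*} [Group G] {Q : Subgroup G}
    (h : Q.IsPerfectCode) {x : G} (hx : x ∈ normalizer (Q : Set G)) (hxx : x * x ∈ Q) :
    ∃ t : G, x⁻¹ * t ∈ Q ∧ t⁻¹ = t := by
  obtain ⟨T, hT, hc⟩ := h
  rw [isComplement_iff_existsUnique_mul_inv_mem] at hc
  obtain ⟨⟨t, htT⟩, ht, -⟩ := hc x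
  have ht : x * t⁻¹ ∈ Q := ht
  have hxt : x⁻¹ * t ∈ Q := by
    have := (mem_normalizer_iff''.1 hx _).1 (Q.inv_mem ht)
    simpa [mul_assoc] using this
  refine ⟨t, hxt, ?_⟩
  have hinvT : t⁻¹ ∈ T := by
    rw [← hT]
    simpa using htT
  have htt : t * t ∈ Q := by
    have h1 : t * x ∈ Q := by
      simpa [mul_assoc] using Q.mul_mem (Q.inv_mem ht) hxx
    simpa [mul_assoc] using Q.mul_mem h1 hxt
  exact congrArg Subtype.val
    ((hc t).unique (y₁ := ⟨t⁻¹, hinvT⟩) (y₂ := ⟨t, htT⟩) (by simpa using htt) (by simp))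

theorem two_subgroup_isPerfectCode_iff_sylow {G : Type*} [Group G] [Finite G]
    (Q : Subgroup G) (hQ : ∃ n : ℕ, Nat.card Q = 2 ^ n) :
    Q.IsPerfectCode ↔
      ∀ P : Sylow 2 G, Q ≤ (P : Subgroup G) →
        (Q.subgroupOf (P : Subgroup G)).IsPerfectCode := by
  refine ⟨fun h P hQP => h.subgroupOf hQP, fun h => ?_⟩
  obtain ⟨n, hn⟩ := hQ
  have hQ2 : IsPGroup 2 Q := IsPGroup.of_card hn
  refine Subgroup.isPerfectCode_of_exists_inv_eq_self hQ2 fun x hx hxx => ?_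
  have hx2 : IsPGroup 2 (Subgroup.zpowers x) := by
    obtain ⟨k, hk⟩ := hQ2 ⟨x * x, hxx⟩
    have hk : x ^ 2 ^ (k + 1) = 1 := by
      rw [pow_succ', pow_mul, pow_two]
      exact congrArg Subtype.val hk
    rintro ⟨_, m, rfl⟩
    refine ⟨k + 1, Subtype.ext ?_⟩
    change (x ^ m) ^ 2 ^ (k + 1) = 1
    rw [← zpow_natCast, zpow_comm, zpow_natCast, hk, one_zpow]
  obtain ⟨P, hP⟩ := (hQ2.to_sup_of_normal_left' hx2
    ((Subgroup.zpowers_le (H := Subgroup.normalizer (Q : Set G))).2 hx)).exists_le_sylow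
  have hQP : Q ≤ P := le_sup_left.trans hP
  have hxP : x ∈ (P : Subgroup G) := hP (le_sup_right (a := Q) (Subgroup.mem_zpowers x))
  obtain ⟨t, ht, htt⟩ := (h P hQP).exists_inv_eq_self (x := ⟨x, hxP⟩)
    (Subgroup.mem_normalizer_iff.2 fun g => Subgroup.mem_normalizer_iff.1 hx g) hxx
  exact ⟨t, (QuotientGroup.eq.2 (Subgroup.mem_subgroupOf.1 ht)).symm, congrArg Subtype.val htt⟩
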